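/- arXiv:2504.09248 — 2 statements merged into one kernel-verified Lean document; each statement's English description precedes it below -/
import Mathlib

section
/- Let q ∈ ℤ with q ≥ 1, let g ∈ ℤ and r ∈ ℝ satisfy |g − r| < q/2. Then ⌊(g − r + q/2)/q⌋ = 0 and g = (g mod q) − ⌊((g mod q) − r + q/2)/q⌋·q. Consequently, for an integer vector v ∈ ℤ^n and r ∈ ℝ^n with ‖v − r‖_∞ < q/2, each component satisfies v_i = (v_i mod q) − ⌊((v_i mod q) − r_i + q/2)/q⌋·q, i.e., v is exactly recovered from its entrywise mod-q reduction together with the side information r. -/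
theorem floor_sub_add_half_div_eq_zero {q : ℤ} (hq : 1 ≤ q) {g : ℤ} {r : ℝ}
    (h : |(g : ℝ) - r| < (q : ℝ) / 2) :
    ⌊((g : ℝ) - r + (q : ℝ) / 2) / (q : ℝ)⌋ = 0 := by
  have hq0 : (0 : ℝ) < q := by exact_mod_cast hq
  obtain ⟨h₁, h₂⟩ := abs_lt.mp h
  rw [Int.floor_eq_zero_iff, Set.mem_Ico, div_lt_one hq0]
  exact ⟨div_nonneg (by linarith) hq0.le, by linarith⟩

theorem eq_emod_sub_floor_mul {q : ℤ} (hq : 1 ≤ q) {g : ℤ} {r : ℝ}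
    (h : |(g : ℝ) - r| < (q : ℝ) / 2) :
    g = g % q - ⌊(((g % q : ℤ) : ℝ) - r + (q : ℝ) / 2) / (q : ℝ)⌋ * q := by
  have hq0 : (q : ℝ) ≠ 0 := by exact_mod_cast (by lia : q ≠ 0)
  have key : (((g % q : ℤ) : ℝ) - r + (q : ℝ) / 2) / (q : ℝ) =
      ((g : ℝ) - r + (q : ℝ) / 2) / (q : ℝ) - ((g / q : ℤ) : ℝ) := by
    rw [Int.emod_def]
    push_cast
    field_simp
    ring
  rw [key, Int.floor_sub_intCast, floor_sub_add_half_div_eq_zero hq h]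
  linarith [Int.emod_add_mul_ediv g q]

/-- exact recovery of an integer from its mod-q reduction given
side information `r` with `|g - r| < q/2`, plus the entrywise vector version
(with `‖·‖_∞` the sup-norm). -/
theorem stmt_0 (q : ℤ) (hq : 1 ≤ q) (g : ℤ) (r : ℝ)
    (h : |(g : ℝ) - r| < (q : ℝ) / 2) :
    (⌊((g : ℝ) - r + (q : ℝ) / 2) / (q : ℝ)⌋ = 0 ∧
      g = g % q - ⌊(((g % q : ℤ) : ℝ) - r + (q : ℝ) / 2) / (q : ℝ)⌋ * q) ∧
    (∀ (n : ℕ) (v : Fin n → ℤ) (rv : Fin n → ℝ),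
      (⨆ i, |(v i : ℝ) - rv i|) < (q : ℝ) / 2 →
      ∀ i, v i = v i % q -
        ⌊(((v i % q : ℤ) : ℝ) - rv i + (q : ℝ) / 2) / (q : ℝ)⌋ * q) := by
  refine ⟨⟨floor_sub_add_half_div_eq_zero hq h, eq_emod_sub_floor_mul hq h⟩,
    fun n v rv hv i => eq_emod_sub_floor_mul hq (lt_of_le_of_lt ?_ hv)⟩
  exact le_ciSup (f := fun j => |(v j : ℝ) - rv j|) (Set.finite_range _).bddAbove i
end

section
/- (Lemma 2.) Let A ∈ ℚ^{n×n}, B ∈ ℚ^{n×w}, C ∈ ℚ^{v×n} with the pair (A,C) observable, and let F ∈ ℚ^{n_x×n_x}, G ∈ ℚ^{n_x×v}, H ∈ ℚ^{w×n_x}, J ∈ ℚ^{w×v}, R ∈ ℚ^{n_x×n_r}, S ∈ ℚ^{w×n_r} be arbitrary rational matrices. Then for every ε > 0 there exist: a rational matrix L ∈ ℚ^{n×v} with (A − LC)^n = 0 (so the spectral radius of A − LC is 0), rationals s₁ > 0 and s₂ > 0 such that (1/s₁)·C, (1/s₂)·H, (1/s₂)·(JC) and (1/s₂)·S are integer matrices,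 and a rational ω with 0 < ω ≤ ε and 1/ω ∈ ℤ such that (1/ω)·A, (1/ω)·(s₂B), (1/ω)·L, (1/ω)·F, (1/ω)·(GC) and (1/ω)·R are integer matrices. -/
open Matrix

section Deadbeat

variable {𝕜 V U : Type*} [Field 𝕜] [AddCommGroup V] [Module 𝕜 V] [AddCommGroup U] [Module 𝕜 U]

/-- The states that the system `x ↦ f x + g u` can steer to `0` in `k` steps. -/
def nullControllable (f : V →ₗ[𝕜] V) (g : U →ₗ[𝕜] V) : ℕ → Submodule 𝕜 V
  | 0 => ⊥
  | k + 1 => (nullControllable f g k ⊔ LinearMap.range g).comap f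

lemma nullControllable_mono (f : V →ₗ[𝕜] V) (g : U →ₗ[𝕜] V) :
    Monotone (nullControllable f g) := by
  refine monotone_nat_of_le_succ fun k => ?_
  induction k with
  | zero => exact bot_le
  | succ k ih => exact Submodule.comap_mono (sup_le_sup_right ih _)

lemma mem_nullControllable_of_pow_apply_eq_sum (f : V →ₗ[𝕜] V) (g : U →ₗ[𝕜] V) (u : ℕ → U)
    (k : ℕ) (x : V) (h : (f ^ k) x = ∑ i ∈ Finset.range k, (f ^ i) (g (u i))) :
    x ∈ nullControllable f g k := by
  induction k generalizing x with
  | zero => simpa [nullControllable] using h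
  | succ k ih =>
    have hmem : f x - g (u k) ∈ nullControllable f g k := by
      apply ih
      rw [Finset.sum_range_succ, pow_succ, Module.End.mul_apply] at h
      rw [map_sub, h, add_sub_cancel_right]
    rw [nullControllable, Submodule.mem_comap, ← sub_add_cancel (f x) (g (u k))]
    exact Submodule.add_mem_sup hmem (LinearMap.mem_range_self g _)

/-- A pointwise choice of inputs steering `W` into `P` can be made linear. -/
lemma exists_linear_steering (f : V →ₗ[𝕜] V) (g : U →ₗ[𝕜] V) (W P : Submodule 𝕜 V)
    (h : W ≤ (P ⊔ LinearMap.range g).comap f) :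
    ∃ T : V →ₗ[𝕜] U, ∀ x ∈ W, f x + g (T x) ∈ P := by
  let q := P.mkQ ∘ₗ g
  have hq : ∀ x : W, (-(P.mkQ ∘ₗ f ∘ₗ W.subtype)) x ∈ LinearMap.range q := by
    intro x
    obtain ⟨p, hp, _, ⟨u, rfl⟩, hpu⟩ := Submodule.mem_sup.1 (h x.2)
    refine ⟨-u, ?_⟩
    simp [q, ← hpu, (Submodule.Quotient.mk_eq_zero P).2 hp]
  obtain ⟨T₀, hT₀⟩ := Module.projective_lifting_property q.rangeRestrict
    (LinearMap.codRestrict _ _ hq) q.surjective_rangeRestrict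
  obtain ⟨T, hT⟩ := T₀.exists_extend
  refine ⟨T, fun x hx => ?_⟩
  have h₁ : T x = T₀ ⟨x, hx⟩ := LinearMap.congr_fun hT ⟨x, hx⟩
  have h₂ : q (T₀ ⟨x, hx⟩) = -P.mkQ (f x) :=
    congrArg Subtype.val (LinearMap.congr_fun hT₀ ⟨x, hx⟩)
  rw [← Submodule.Quotient.mk_eq_zero, ← Submodule.mkQ_apply, map_add, h₁]
  change P.mkQ (f x) + q (T₀ ⟨x, hx⟩) = 0
  rw [h₂, add_neg_cancel]

lemma exists_feedback_nullControllable (f : V →ₗ[𝕜] V) (g : U →ₗ[𝕜] V) (k : ℕ) :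
    ∃ K : V →ₗ[𝕜] U, ∀ j < k, ∀ x ∈ nullControllable f g (j + 1),
      f x + g (K x) ∈ nullControllable f g j := by
  induction k with
  | zero => exact ⟨0, by simp⟩
  | succ k ih =>
    obtain ⟨K, hK⟩ := ih
    obtain ⟨T, hT⟩ := exists_linear_steering f g (nullControllable f g (k + 1))
      (nullControllable f g k) le_rfl
    obtain ⟨π, hπ⟩ := (nullControllable f g k).subtype.exists_leftInverse_of_injective
      (Submodule.ker_subtype _)
    let p : V →ₗ[𝕜] V := (nullControllable f g k).subtype ∘ₗ π
    have hp : ∀ x, p x ∈ nullControllable f g k := fun x => (π x).2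
    have hpx : ∀ x ∈ nullControllable f g k, p x = x := fun x hx =>
      congrArg Subtype.val (LinearMap.congr_fun hπ ⟨x, hx⟩)
    refine ⟨K ∘ₗ p + T ∘ₗ (LinearMap.id - p), fun j hj x hx => ?_⟩
    rcases Nat.lt_succ_iff_lt_or_eq.1 hj with hj | rfl
    · simpa [hpx x (nullControllable_mono f g hj hx)] using hK j hj x hx
    · have h₁ : f (p x) + g (K (p x)) ∈ nullControllable f g j := by
        cases j with
        | zero =>
          have : p x = 0 := hp x
          simp [this]
        | succ m => exact nullControllable_mono f g m.le_succ (hK m m.lt_succ_self _ (hp x))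
      have h₂ := hT (x - p x)
        (Submodule.sub_mem _ hx (nullControllable_mono f g j.le_succ (hp x)))
      convert Submodule.add_mem _ h₁ h₂ using 1
      simp only [LinearMap.add_apply, LinearMap.comp_apply, LinearMap.sub_apply,
        LinearMap.id_apply, map_add, map_sub]
      abel

/-- A controllable pair admits a deadbeat state feedback. -/
lemma exists_deadbeat_feedback (f : V →ₗ[𝕜] V) (g : U →ₗ[𝕜] V) (n : ℕ)
    (h : ∀ y, ∃ u : ℕ → U, y = ∑ i ∈ Finset.range n, (f ^ i) (g (u i))) :
    ∃ K : V →ₗ[𝕜] U, (f + g ∘ₗ K) ^ n = 0 := by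
  obtain ⟨K, hK⟩ := exists_feedback_nullControllable f g n
  have key : ∀ k ≤ n, ∀ x ∈ nullControllable f g k, ((f + g ∘ₗ K) ^ k) x = 0 := by
    intro k
    induction k with
    | zero => exact fun _ x hx => hx
    | succ k ih =>
      intro hk x hx
      rw [pow_succ, Module.End.mul_apply]
      exact ih (Nat.le_of_succ_le hk) _ (hK k hk x hx)
  refine ⟨K, LinearMap.ext fun x => ?_⟩
  obtain ⟨u, hu⟩ := h ((f ^ n) x)
  exact key n le_rfl x (mem_nullControllable_of_pow_apply_eq_sum f g u n x hu)

end Deadbeat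

/-- An observable pair admits a deadbeat observer gain. -/
lemma exists_deadbeat_gain {𝕜 : Type*} [Field 𝕜] {n v : ℕ} (A : Matrix (Fin n) (Fin n) 𝕜)
    (C : Matrix (Fin v) (Fin n) 𝕜)
    (hobs : (Matrix.of fun (p : Fin n × Fin v) (j : Fin n) =>
      (C * A ^ (p.1 : ℕ)) p.2 j).rank = n) :
    ∃ L : Matrix (Fin n) (Fin v) 𝕜, (A - L * C) ^ n = 0 := by
  set O := Matrix.of fun (p : Fin n × Fin v) (j : Fin n) => (C * A ^ (p.1 : ℕ)) p.2 j with hO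
  have hsurj : LinearMap.range Oᵀ.mulVecLin = ⊤ := by
    apply Submodule.eq_top_of_finrank_eq
    rw [← rank_transpose] at hobs
    simpa [Matrix.rank] using hobs
  obtain ⟨K, hK⟩ := exists_deadbeat_feedback (toLin' Aᵀ) (toLin' Cᵀ) n (by
    intro y
    obtain ⟨c, rfl⟩ := LinearMap.range_eq_top.1 hsurj y
    refine ⟨fun i s => if hi : i < n then c (⟨i, hi⟩, s) else 0, ?_⟩
    rw [Finset.sum_range]
    ext j
    simp only [Fin.is_lt, dite_true, Fin.eta, ← toLin'_pow, toLin'_apply, Finset.sum_apply,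
      mulVec_mulVec, ← transpose_pow, ← transpose_mul, mulVecLin_apply]
    simp only [mulVec, dotProduct, Fintype.sum_prod_type, hO, transpose_apply, of_apply])
  refine ⟨-(LinearMap.toMatrix' K)ᵀ, ?_⟩
  rw [← transpose_eq_zero, transpose_pow]
  apply toLin'.injective
  rw [toLin'_pow, map_zero, ← hK]
  congr 1
  simp [transpose_mul, toLin'_mul]

/-- The entries of a rational matrix have a common denominator. -/
lemma exists_common_den {l m : Type*} [Fintype l] [Fintype m] (M : Matrix l m ℚ) :
    ∃ N : ℕ, 0 < N ∧ ∀ N', N ∣ N' → ∀ i j, ∃ z : ℤ, (N' : ℚ) * M i j = z := by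
  refine ⟨∏ i, ∏ j, (M i j).den,
    Finset.prod_pos fun i _ => Finset.prod_pos fun j _ => (M i j).pos, fun N' hN i j => ?_⟩
  obtain ⟨c, rfl⟩ : (M i j).den ∣ N' :=
    ((Finset.dvd_prod_of_mem (fun j => (M i j).den) (Finset.mem_univ j)).trans
      (Finset.dvd_prod_of_mem (fun i => ∏ j, (M i j).den) (Finset.mem_univ i))).trans hN
  refine ⟨c * (M i j).num, ?_⟩
  push_cast
  rw [mul_comm ((M i j).den : ℚ), mul_assoc, Rat.den_mul_eq_num]

/-- Lemma 2: for an observable rational pair `(A,C)` and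
arbitrary rational controller matrices, there are a rational deadbeat observer
gain `L` (with `(A − LC)^n = 0`), scalings `s₁, s₂ > 0` making `C/s₁`, `H/s₂`,
`JC/s₂`, `S/s₂` integer matrices, and an arbitrarily small rational `ω`
with `1/ω ∈ ℤ` making `A/ω`, `s₂B/ω`, `L/ω`, `F/ω`, `GC/ω`, `R/ω` integer
matrices. -/
theorem stmt_5 (n w v nx nr : ℕ)
    (A : Matrix (Fin n) (Fin n) ℚ) (B : Matrix (Fin n) (Fin w) ℚ)
    (C : Matrix (Fin v) (Fin n) ℚ)
    (hobs : (Matrix.of fun (p : Fin n × Fin v) (j : Fin n) =>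
      (C * A ^ (p.1 : ℕ)) p.2 j).rank = n)
    (F : Matrix (Fin nx) (Fin nx) ℚ) (G : Matrix (Fin nx) (Fin v) ℚ)
    (H : Matrix (Fin w) (Fin nx) ℚ) (J : Matrix (Fin w) (Fin v) ℚ)
    (R : Matrix (Fin nx) (Fin nr) ℚ) (S : Matrix (Fin w) (Fin nr) ℚ) :
    ∀ ε : ℝ, 0 < ε →
    ∃ L : Matrix (Fin n) (Fin v) ℚ, (A - L * C) ^ n = 0 ∧
    ∃ s₁ : ℚ, 0 < s₁ ∧ ∃ s₂ : ℚ, 0 < s₂ ∧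
      (∀ i j, ∃ z : ℤ, (1 / s₁) * C i j = (z : ℚ)) ∧
      (∀ i j, ∃ z : ℤ, (1 / s₂) * H i j = (z : ℚ)) ∧
      (∀ i j, ∃ z : ℤ, (1 / s₂) * (J * C) i j = (z : ℚ)) ∧
      (∀ i j, ∃ z : ℤ, (1 / s₂) * S i j = (z : ℚ)) ∧
      ∃ ω : ℚ, 0 < ω ∧ (ω : ℝ) ≤ ε ∧ (∃ z : ℤ, (1 / ω) = (z : ℚ)) ∧
        (∀ i j, ∃ z : ℤ, (1 / ω) * A i j = (z : ℚ)) ∧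
        (∀ i j, ∃ z : ℤ, (1 / ω) * (s₂ * B i j) = (z : ℚ)) ∧
        (∀ i j, ∃ z : ℤ, (1 / ω) * L i j = (z : ℚ)) ∧
        (∀ i j, ∃ z : ℤ, (1 / ω) * F i j = (z : ℚ)) ∧
        (∀ i j, ∃ z : ℤ, (1 / ω) * (G * C) i j = (z : ℚ)) ∧
        (∀ i j, ∃ z : ℤ, (1 / ω) * R i j = (z : ℚ)) := by
  intro ε hε
  obtain ⟨L, hL⟩ := exists_deadbeat_gain A C hobs
  obtain ⟨c, hc, hC⟩ := exists_common_den C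
  obtain ⟨h, hh, hH⟩ := exists_common_den H
  obtain ⟨k, hk, hJC⟩ := exists_common_den (J * C)
  obtain ⟨s, hs, hS⟩ := exists_common_den S
  obtain ⟨a, ha, hA⟩ := exists_common_den A
  obtain ⟨b, hb, hB⟩ := exists_common_den ((1 / ((h * k * s : ℕ) : ℚ)) • B)
  obtain ⟨l, hl, hL'⟩ := exists_common_den L
  obtain ⟨f, hf, hF⟩ := exists_common_den F
  obtain ⟨g, hg, hGC⟩ := exists_common_den (G * C)
  obtain ⟨r, hr, hR⟩ := exists_common_den R
  obtain ⟨e, he⟩ := exists_nat_one_div_lt hε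
  let N := a * b * l * f * g * r * (e + 1)
  have hN : 0 < N := by positivity
  have heN : e + 1 ≤ N := Nat.le_of_dvd hN (Dvd.intro_left _ rfl)
  refine ⟨L, hL, 1 / (c : ℚ), by positivity, 1 / ((h * k * s : ℕ) : ℚ), by positivity, ?_⟩
  simp only [one_div_one_div]
  refine ⟨hC _ dvd_rfl, hH _ ⟨k * s, by ring⟩, hJC _ ⟨h * s, by ring⟩, hS _ ⟨h * k, by ring⟩,
    1 / (N : ℚ), by positivity, ?_, ?_⟩
  · refine le_trans ?_ he.le
    push_cast
    exact one_div_le_one_div_of_le (by positivity) (by exact_mod_cast heN)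
  simp only [one_div_one_div]
  exact ⟨⟨N, by simp⟩,
    hA _ ⟨b * l * f * g * r * (e + 1), by ring⟩,
    hB _ ⟨a * l * f * g * r * (e + 1), by ring⟩,
    hL' _ ⟨a * b * f * g * r * (e + 1), by ring⟩,
    hF _ ⟨a * b * l * g * r * (e + 1), by ring⟩,
    hGC _ ⟨a * b * l * f * r * (e + 1), by ring⟩,
    hR _ ⟨a * b * l * f * g * (e + 1), by ring⟩⟩
end
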